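/- There exist universal constants ε₀ > 0 and C > 0 such that the following holds. Let G* be a set of n points in ℝ^d that is (ε,δ)-spectrally stable with respect to μ ∈ ℝ^d, where 0 < ε ≤ min(δ, ε₀). Let S be an ε-corruption of G*, let G be the set of unchanged indices (|G| ≥ (1−ε)n), and let w* be the uniform weights on G. Then for every w ∈ Δ_{n,ε}, computing μ_w and Σ_w from the corrupted samples S: ‖μ_w − μ_{w*}‖₂² ≤ 4ε·(‖Σ_w − I‖₂ + C·δ²/ε), where ‖·‖₂ on matrices denotes the spectral norm. -/

import Mathlib

open Finset MeasureTheory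

/-- Euclidean (`ℓ₂`) norm of a vector in `ℝ^d`. -/
noncomputable def norm2 {d : ℕ} (x : Fin d → ℝ) : ℝ :=
  Real.sqrt (∑ i, (x i) ^ 2)

/-- The `(2,k)`-norm: max `ℓ₂` norm over `k` entries. -/
noncomputable def norm2k {d : ℕ} (k : ℕ) (x : Fin d → ℝ) : ℝ :=
  sSup {r : ℝ | ∃ S : Finset (Fin d), S.card = k ∧ r = Real.sqrt (∑ i ∈ S, (x i) ^ 2)}

/-- The `(F,k,k)`-norm: `‖A‖_{F,k,k}² = max_{|S|=k} Σ_{i∈S} ‖A_i‖_{2,k}²`. -/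
noncomputable def normFkk {d : ℕ} (k : ℕ) (A : Matrix (Fin d) (Fin d) ℝ) : ℝ :=
  Real.sqrt (sSup {r : ℝ | ∃ S : Finset (Fin d), S.card = k ∧
    r = ∑ i ∈ S, (norm2k k (A i)) ^ 2})

/-- The `(F,m)`-norm: max Frobenius norm over `m` entries of the matrix. -/
noncomputable def normFm {d : ℕ} (m : ℕ) (A : Matrix (Fin d) (Fin d) ℝ) : ℝ :=
  sSup {r : ℝ | ∃ Q : Finset (Fin d × Fin d), Q.card = m ∧
    r = Real.sqrt (∑ p ∈ Q, (A p.1 p.2) ^ 2)}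

/-- Frobenius norm. -/
noncomputable def frobNorm {d : ℕ} (A : Matrix (Fin d) (Fin d) ℝ) : ℝ :=
  Real.sqrt (∑ a, ∑ b, (A a b) ^ 2)

/-- Spectral norm (operator `ℓ₂ → ℓ₂` norm). -/
noncomputable def specNorm {d : ℕ} (A : Matrix (Fin d) (Fin d) ℝ) : ℝ :=
  sSup {r : ℝ | ∃ x : Fin d → ℝ, norm2 x = 1 ∧ r = norm2 (A.mulVec x)}

/-- Quadratic form `vᵀ A v`. -/
noncomputable def quadForm {d : ℕ} (A : Matrix (Fin d) (Fin d) ℝ) (v : Fin d → ℝ) : ℝ :=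
  ∑ a, ∑ b, v a * A a b * v b

/-- Ky Fan 2-norm of a symmetric matrix: max of `|uᵀAu| + |vᵀAv|` over orthonormal pairs. -/
noncomputable def kyFan2 {d : ℕ} (A : Matrix (Fin d) (Fin d) ℝ) : ℝ :=
  sSup {r : ℝ | ∃ u v : Fin d → ℝ, norm2 u = 1 ∧ norm2 v = 1 ∧ (∑ i, u i * v i) = 0 ∧
    r = |quadForm A u| + |quadForm A v|}

/-- `x` has at most `k` nonzero entries. -/
def sparseLE {d : ℕ} (k : ℕ) (x : Fin d → ℝ) : Prop :=
  ∃ S : Finset (Fin d), S.card ≤ k ∧ ∀ i, i ∉ S → x i = 0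

/-- `A_Q`: the matrix equal to `A` on the entry set `Q` and zero elsewhere. -/
def matRestrict {d : ℕ} (A : Matrix (Fin d) (Fin d) ℝ) (Q : Finset (Fin d × Fin d)) :
    Matrix (Fin d) (Fin d) ℝ :=
  Matrix.of fun a b => if (a, b) ∈ Q then A a b else 0

/-- `Δ_{n,ε}`. -/
def Delta (n : ℕ) (ε : ℝ) : Set (Fin n → ℝ) :=
  {w | (∑ i, w i) = 1 ∧ ∀ i, 0 ≤ w i ∧ w i ≤ 1 / ((1 - ε) * n)}

/-- Weighted empirical mean `μ_w`. -/
noncomputable def muW {n d : ℕ} (X : Fin n → Fin d → ℝ) (w : Fin n → ℝ) : Fin d → ℝ :=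
  fun j => ∑ i, w i * X i j

/-- Weighted empirical covariance `Σ_w`. -/
noncomputable def SigmaW {n d : ℕ} (X : Fin n → Fin d → ℝ) (w : Fin n → ℝ) :
    Matrix (Fin d) (Fin d) ℝ :=
  Matrix.of fun a b => ∑ i, w i * (X i a - muW X w a) * (X i b - muW X w b)

/-- Weighted second moment `M_w`. -/
noncomputable def MW {n d : ℕ} (X : Fin n → Fin d → ℝ) (w : Fin n → ℝ) :
    Matrix (Fin d) (Fin d) ℝ :=
  Matrix.of fun a b => ∑ i, w i * X i a * X i b

/-- `(k,ε,δ)`-stability for sparse mean estimation. -/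
def stableMean {n d : ℕ} (k : ℕ) (ε δ : ℝ) (X : Fin n → Fin d → ℝ) (μ : Fin d → ℝ) : Prop :=
  ∀ w ∈ Delta n (2 * ε),
    norm2k k (fun j => muW X w j - μ j) ≤ δ ∧ normFkk k (SigmaW X w - 1) ≤ δ ^ 2 / ε

/-- `(ε,δ)`-spectral stability for (non-sparse) mean estimation. -/
def stableSpec {n d : ℕ} (ε δ : ℝ) (X : Fin n → Fin d → ℝ) (μ : Fin d → ℝ) : Prop :=
  ∀ w ∈ Delta n (2 * ε),
    norm2 (fun j => muW X w j - μ j) ≤ δ ∧ specNorm (SigmaW X w - 1) ≤ δ ^ 2 / ε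

/-- `(k,ε,δ)`-stability for sparse PCA. -/
def stablePCA {n d : ℕ} (k : ℕ) (ε δ ρ : ℝ) (X : Fin n → Fin d → ℝ) (v : Fin d → ℝ) : Prop :=
  ∀ w ∈ Delta n (2 * ε),
    normFm (2 * k ^ 2) (MW X w - (1 + ρ • Matrix.vecMulVec v v)) ≤ δ

/-- `(ε,δ)`-KF2-stability for (non-sparse) PCA. -/
def stableKF2 {n d : ℕ} (ε δ ρ : ℝ) (X : Fin n → Fin d → ℝ) (v : Fin d → ℝ) : Prop :=
  ∀ w ∈ Delta n (2 * ε),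
    kyFan2 (MW X w - (1 + ρ • Matrix.vecMulVec v v)) ≤ δ

/-- `X` is an `ε`-corruption of `Xstar`: they differ in at most `εn` indices. -/
def isCorruption {n d : ℕ} (ε : ℝ) (X Xstar : Fin n → Fin d → ℝ) : Prop :=
  ∃ B : Finset (Fin n), (B.card : ℝ) ≤ ε * n ∧ ∀ i, i ∉ B → X i = Xstar i

/-- Uniform weight vector on a finite index set `G`. -/
noncomputable def uniformOn {n : ℕ} (G : Finset (Fin n)) : Fin n → ℝ :=
  fun i => if i ∈ G then ((G.card : ℝ))⁻¹ else 0

lemma dotProduct_le_norm2_mul_norm2 {d : ℕ} (u v : Fin d → ℝ) :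
    |u ⬝ᵥ v| ≤ norm2 u * norm2 v := by
  unfold norm2 dotProduct
  rw [← Real.sqrt_mul (Finset.sum_nonneg fun i _ => sq_nonneg _)]
  exact Real.abs_le_sqrt (Finset.sum_mul_sq_le_sq_mul_sq _ _ _)

lemma norm2_sq {d : ℕ} (u : Fin d → ℝ) : norm2 u ^ 2 = u ⬝ᵥ u := by
  unfold norm2 dotProduct
  rw [Real.sq_sqrt (Finset.sum_nonneg fun i _ => sq_nonneg _)]
  simp only [sq]

lemma norm2_nonneg {d : ℕ} (u : Fin d → ℝ) : 0 ≤ norm2 u := Real.sqrt_nonneg _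

lemma specNorm_nonneg {d : ℕ} (A : Matrix (Fin d) (Fin d) ℝ) : 0 ≤ specNorm A := by
  apply Real.sSup_nonneg
  rintro r ⟨x, -, rfl⟩
  exact norm2_nonneg _

lemma norm2_mulVec_le_frobNorm {d : ℕ} (A : Matrix (Fin d) (Fin d) ℝ) {x : Fin d → ℝ}
    (hx : norm2 x = 1) : norm2 (A.mulVec x) ≤ frobNorm A := by
  have hx' : ∑ i, x i ^ 2 = 1 := by
    simpa [norm2] using hx
  refine Real.sqrt_le_sqrt (Finset.sum_le_sum fun a _ => ?_)
  simpa [hx', Matrix.mulVec, dotProduct] using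
    Finset.sum_mul_sq_le_sq_mul_sq Finset.univ (A a) x

lemma abs_dotProduct_mulVec_le_specNorm {d : ℕ} (A : Matrix (Fin d) (Fin d) ℝ) {v : Fin d → ℝ}
    (hv : norm2 v = 1) : |v ⬝ᵥ A.mulVec v| ≤ specNorm A := by
  refine (dotProduct_le_norm2_mul_norm2 _ _).trans ?_
  rw [hv, one_mul]
  refine le_csSup ⟨frobNorm A, ?_⟩ ⟨v, hv, rfl⟩
  rintro r ⟨x, hx, rfl⟩
  exact norm2_mulVec_le_frobNorm A hx

lemma dotProduct_muW {n d : ℕ} (X : Fin n → Fin d → ℝ) (w : Fin n → ℝ) (v : Fin d → ℝ) :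
    v ⬝ᵥ muW X w = ∑ i, w i * (v ⬝ᵥ X i) := by
  simp only [dotProduct, muW, Finset.mul_sum]
  rw [Finset.sum_comm]
  exact Finset.sum_congr rfl fun i _ => Finset.sum_congr rfl fun j _ => by ring

lemma dotProduct_SigmaW_mulVec {n d : ℕ} (X : Fin n → Fin d → ℝ) (w : Fin n → ℝ)
    (v : Fin d → ℝ) :
    v ⬝ᵥ (SigmaW X w).mulVec v = ∑ i, w i * (v ⬝ᵥ X i - v ⬝ᵥ muW X w) ^ 2 := by
  have h : ∀ i, w i * (v ⬝ᵥ X i - v ⬝ᵥ muW X w) ^ 2 =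
      ∑ a, ∑ b, v a * (w i * (X i a - muW X w a) * (X i b - muW X w b) * v b) := by
    intro i
    rw [← dotProduct_sub, sq, dotProduct, Finset.sum_mul_sum, Finset.mul_sum]
    refine Finset.sum_congr rfl fun a _ => ?_
    rw [Finset.mul_sum]
    exact Finset.sum_congr rfl fun b _ => by simp only [Pi.sub_apply]; ring
  simp only [h]
  rw [Finset.sum_comm]
  simp only [dotProduct, Matrix.mulVec, SigmaW, Matrix.of_apply]
  refine Finset.sum_congr rfl fun a _ => ?_
  rw [Finset.sum_comm, Finset.mul_sum]
  refine Finset.sum_congr rfl fun b _ => ?_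
  rw [Finset.sum_mul, Finset.mul_sum]

/-- The variance of a one-dimensional projection deviates from `1` by at most
the spectral norm of `Σ_w − I`. -/
lemma abs_variance_sub_one_le_specNorm {n d : ℕ} (X : Fin n → Fin d → ℝ) (w : Fin n → ℝ)
    {v : Fin d → ℝ} (hv : norm2 v = 1) :
    |∑ i, w i * (v ⬝ᵥ X i - v ⬝ᵥ muW X w) ^ 2 - 1| ≤ specNorm (SigmaW X w - 1) := by
  have h := abs_dotProduct_mulVec_le_specNorm (SigmaW X w - 1) hv
  rwa [Matrix.sub_mulVec, Matrix.one_mulVec, dotProduct_sub, dotProduct_SigmaW_mulVec,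
    ← norm2_sq, hv, one_pow] at h

/-- Shift of the mean of a mixture `w = (1 − β) w' + b`, bounded by the excess variance. -/
lemma sq_mean_shift_le {ι : Type*} [Fintype ι] (y w w' b : ι → ℝ) (β : ℝ)
    (hw : ∀ i, w i = (1 - β) * w' i + b i) (hb : ∀ i, 0 ≤ b i) (hb1 : ∑ i, b i = β)
    (hw'1 : ∑ i, w' i = 1) :
    (1 - β) * (∑ i, w i * y i - ∑ i, w' i * y i) ^ 2 ≤
      β * (∑ i, w i * (y i - ∑ i, w i * y i) ^ 2
        - (1 - β) * ∑ i, w' i * (y i - ∑ i, w' i * y i) ^ 2) := by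
  set m := ∑ i, w i * y i with hm
  set m' := ∑ i, w' i * y i with hm'
  have hw1 : ∑ i, w i = 1 := by
    simp only [hw, Finset.sum_add_distrib, ← Finset.mul_sum, hw'1, hb1]; ring
  have hmean : ∑ i, b i * (y i - m') = m - m' := by
    have : ∀ i, b i * (y i - m') =
        w i * y i - (1 - β) * (w' i * y i) - b i * m' := fun i => by rw [hw]; ring
    simp only [this, Finset.sum_sub_distrib, ← Finset.mul_sum, ← Finset.sum_mul, hb1, ← hm, ← hm']
    ring
  have hsq : ∑ i, b i * (y i - m') ^ 2 =
      ∑ i, w i * (y i - m) ^ 2 + (m - m') ^ 2 - (1 - β) * ∑ i, w' i * (y i - m') ^ 2 := by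
    have : ∀ i, b i * (y i - m') ^ 2 = w i * (y i - m) ^ 2 + 2 * (m - m') * (w i * y i)
        - w i * (m ^ 2 - m' ^ 2) - (1 - β) * (w' i * (y i - m') ^ 2) :=
      fun i => by rw [hw]; ring
    simp only [this, Finset.sum_sub_distrib, Finset.sum_add_distrib, ← Finset.mul_sum,
      ← Finset.sum_mul, hw1, ← hm]
    ring
  have hcs : (∑ i, b i * (y i - m')) ^ 2 ≤ (∑ i, b i) * ∑ i, b i * (y i - m') ^ 2 :=
    Finset.sum_sq_le_sum_mul_sum_of_sq_le_mul _ (fun i _ => hb i)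
      (fun i _ => mul_nonneg (hb i) (sq_nonneg _)) (fun i _ => le_of_eq (by ring))
  rw [hmean, hb1, hsq] at hcs
  linarith

lemma muW_congr_of_support {n d : ℕ} {X Y : Fin n → Fin d → ℝ} {w : Fin n → ℝ}
    (h : ∀ i, w i ≠ 0 → X i = Y i) : muW X w = muW Y w := by
  funext j
  refine Finset.sum_congr rfl fun i _ => ?_
  by_cases hi : w i = 0
  · simp [hi]
  · rw [h i hi]

lemma SigmaW_congr_of_support {n d : ℕ} {X Y : Fin n → Fin d → ℝ} {w : Fin n → ℝ}
    (h : ∀ i, w i ≠ 0 → X i = Y i) : SigmaW X w = SigmaW Y w := by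
  ext a b
  simp only [SigmaW, Matrix.of_apply, muW_congr_of_support h]
  refine Finset.sum_congr rfl fun i _ => ?_
  by_cases hi : w i = 0
  · simp [hi]
  · rw [h i hi]

lemma uniformOn_mem_Delta {n : ℕ} {ε : ℝ} {G : Finset (Fin n)} (hn : 0 < n) (hε : 0 < ε)
    (hε' : ε ≤ 1 / 10) (hG : (1 - ε) * n ≤ (G.card : ℝ)) : uniformOn G ∈ Delta n (2 * ε) := by
  have hn' : (0 : ℝ) < n := by exact_mod_cast hn
  have hG0 : (0 : ℝ) < G.card := lt_of_lt_of_le (by nlinarith) hG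
  refine ⟨?_, fun i => ?_⟩
  · simp [uniformOn, Finset.sum_ite_mem, hG0.ne']
  · have hpos : 0 < (1 - 2 * ε) * n := by nlinarith
    unfold uniformOn
    split_ifs
    · refine ⟨by positivity, ?_⟩
      rw [inv_eq_one_div]
      exact one_div_le_one_div_of_le hpos (by nlinarith)
    · exact ⟨le_rfl, by positivity⟩

lemma sum_compl_le_of_mem_Delta {n : ℕ} {ε : ℝ} {G : Finset (Fin n)} {w : Fin n → ℝ}
    (hn : 0 < n) (hε' : ε < 1) (hG : (1 - ε) * n ≤ (G.card : ℝ))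
    (hw : w ∈ Delta n ε) : ∑ i ∈ Gᶜ, w i ≤ ε / (1 - ε) := by
  have hn' : (0 : ℝ) < n := by exact_mod_cast hn
  have hcard : ((Gᶜ : Finset (Fin n)).card : ℝ) = n - G.card := by
    rw [Finset.card_compl, Fintype.card_fin, Nat.cast_sub (by simpa using G.card_le_univ)]
  have hpos : 0 < 1 - ε := by linarith
  calc ∑ i ∈ Gᶜ, w i ≤ ∑ _i ∈ Gᶜ, 1 / ((1 - ε) * n) :=
        Finset.sum_le_sum fun i _ => (hw.2 i).2
    _ = (n - G.card) * (1 / ((1 - ε) * n)) := by rw [Finset.sum_const, nsmul_eq_mul, hcard]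
    _ ≤ (ε * n) * (1 / ((1 - ε) * n)) := by gcongr; linarith
    _ = ε / (1 - ε) := by field_simp

/-- Restricting `w ∈ Δ_{n,ε}` to `G` and renormalizing stays in `Δ_{n,2ε}`. -/
lemma restrict_mem_Delta {n : ℕ} {ε β : ℝ} {G : Finset (Fin n)} {w : Fin n → ℝ} (hn : 0 < n)
    (hε : 0 < ε) (hε' : ε ≤ 1 / 10) (hG : (1 - ε) * n ≤ (G.card : ℝ)) (hw : w ∈ Delta n ε)
    (hβ : β = ∑ i ∈ Gᶜ, w i) :
    (fun i => if i ∈ G then w i / (1 - β) else 0) ∈ Delta n (2 * ε) := by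
  have hn' : (0 : ℝ) < n := by exact_mod_cast hn
  have hβ' : β ≤ ε / (1 - ε) := hβ ▸ sum_compl_le_of_mem_Delta hn (by linarith) hG hw
  have h1 : (0 : ℝ) < 1 - ε := by linarith
  have h2 : (0 : ℝ) < 1 - 2 * ε := by linarith
  have h3 : (1 - 2 * ε) / (1 - ε) ≤ 1 - β := by
    have : (1 - 2 * ε) / (1 - ε) = 1 - ε / (1 - ε) := by field_simp; ring
    linarith
  have h4 : 0 < 1 - β := lt_of_lt_of_le (by positivity) h3
  refine ⟨?_, fun i => ?_⟩
  · rw [Finset.sum_ite_mem, Finset.univ_inter, ← Finset.sum_div,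
      div_eq_one_iff_eq h4.ne', hβ, ← hw.1, ← Finset.sum_add_sum_compl G w]
    ring
  · dsimp only
    split_ifs
    · refine ⟨div_nonneg (hw.2 i).1 h4.le, ?_⟩
      calc w i / (1 - β) ≤ (1 / ((1 - ε) * n)) / ((1 - 2 * ε) / (1 - ε)) :=
            div_le_div₀ (by positivity) (hw.2 i).2 (by positivity) h3
        _ = 1 / ((1 - 2 * ε) * n) := by field_simp
    · exact ⟨le_rfl, by positivity⟩

lemma exists_norm2_eq_one_dotProduct_eq {d : ℕ} {u : Fin d → ℝ} (hu : norm2 u ≠ 0) :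
    ∃ v : Fin d → ℝ, norm2 v = 1 ∧ v ⬝ᵥ u = norm2 u := by
  have h : ((norm2 u)⁻¹ • u) ⬝ᵥ u = norm2 u := by
    rw [smul_dotProduct, ← norm2_sq, smul_eq_mul]; field_simp
  refine ⟨(norm2 u)⁻¹ • u, ?_, h⟩
  rw [← pow_left_inj₀ (norm2_nonneg _) zero_le_one two_ne_zero, norm2_sq, dotProduct_smul, h,
    smul_eq_mul, inv_mul_cancel₀ hu, one_pow]

/-- (non-sparse, spectral-norm analogue of Statement 4) the cross term
`‖μ_w − μ_{w*}‖₂²` is controlled by the spectral norm of `Σ_w − I`. -/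
theorem stmt17 :
    ∃ ε₀ > (0:ℝ), ∃ C > (0:ℝ),
      ∀ (n d : ℕ) (ε δ : ℝ) (μ : Fin d → ℝ) (Xstar X : Fin n → Fin d → ℝ)
        (G : Finset (Fin n)) (wstar : Fin n → ℝ),
        0 < ε → ε ≤ δ → ε ≤ ε₀ →
        stableSpec ε δ Xstar μ →
        isCorruption ε X Xstar →
        (∀ i ∈ G, X i = Xstar i) →
        (1 - ε) * n ≤ (G.card : ℝ) →
        wstar = uniformOn G →
        ∀ w ∈ Delta n ε,
          (norm2 (fun j => muW X w j - muW X wstar j)) ^ 2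
            ≤ 4 * ε * (specNorm (SigmaW X w - 1) + C * δ ^ 2 / ε) := by
  refine ⟨1 / 10, by norm_num, 10, by norm_num, ?_⟩
  intro n d ε δ μ Xstar X G wstar hε hεδ hε' hstab _ hX hG hwstar w hw
  have hn : 0 < n := by
    rcases Nat.eq_zero_or_pos n with rfl | h
    · simpa using hw.1
    · exact h
  have hlam := specNorm_nonneg (SigmaW X w - 1)
  set lam := specNorm (SigmaW X w - 1) with hlam_def
  have hrhs : 4 * ε * (lam + 10 * δ ^ 2 / ε) = 4 * ε * lam + 40 * δ ^ 2 := by field_simp; ring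
  rw [hrhs]
  set u : Fin d → ℝ := fun j => muW X w j - muW X wstar j with hu
  by_cases hu0 : norm2 u = 0
  · rw [hu0, zero_pow two_ne_zero]; positivity
  obtain ⟨v, hv, hvu⟩ := exists_norm2_eq_one_dotProduct_eq hu0
  set β := ∑ i ∈ Gᶜ, w i with hβ
  set w' : Fin n → ℝ := fun i => if i ∈ G then w i / (1 - β) else 0 with hw'
  have hβ0 : 0 ≤ β := Finset.sum_nonneg fun i _ => (hw.2 i).1
  have hβ1 : β * (1 - ε) ≤ ε :=
    (le_div_iff₀ (by linarith)).1 (sum_compl_le_of_mem_Delta hn (by linarith) hG hw)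
  have hβ2 : β ≤ 10 / 9 * ε := by nlinarith
  have hw'mem : w' ∈ Delta n (2 * ε) := restrict_mem_Delta hn hε hε' hG hw hβ
  have hsupp' : ∀ i, w' i ≠ 0 → X i = Xstar i := fun i hi => hX i (by
    by_contra h; exact hi (by simp [hw', h]))
  have hsupp : ∀ i, wstar i ≠ 0 → X i = Xstar i := fun i hi => hX i (by
    by_contra h; exact hi (by simp [hwstar, uniformOn, h]))
  have hproj : ∀ z : Fin n → ℝ, z ∈ Delta n (2 * ε) → (∀ i, z i ≠ 0 → X i = Xstar i) →
      |v ⬝ᵥ muW X z - v ⬝ᵥ μ| ≤ δ := by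
    intro z hz hs
    rw [muW_congr_of_support hs, ← dotProduct_sub]
    refine (dotProduct_le_norm2_mul_norm2 _ _).trans ?_
    rw [hv, one_mul]
    exact (hstab z hz).1
  have hmean' := abs_le.1 (hproj w' hw'mem hsupp')
  have hmean := abs_le.1
    (hproj wstar (hwstar ▸ uniformOn_mem_Delta hn hε hε' hG) hsupp)
  have hspec' : specNorm (SigmaW X w' - 1) ≤ δ ^ 2 / ε := by
    rw [SigmaW_congr_of_support hsupp']
    exact (hstab w' hw'mem).2
  have hvar' := abs_le.1 ((abs_variance_sub_one_le_specNorm X w' hv).trans hspec')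
  have hvar := abs_le.1 (abs_variance_sub_one_le_specNorm X w hv)
  have hshift := sq_mean_shift_le (fun i => v ⬝ᵥ X i) w w' (fun i => if i ∈ G then 0 else w i) β
    (fun i => by
      have : 1 - β ≠ 0 := by linarith
      by_cases hi : i ∈ G
      · simp only [hw', hi, if_true]; field_simp; rw [add_zero]
      · simp [hw', hi])
    (fun i => by
      split_ifs
      · exact le_rfl
      · exact (hw.2 i).1)
    (by rw [hβ, ← Finset.sum_subset (Finset.subset_univ Gᶜ)
          (fun i _ hi => by simp_all)]
        exact Finset.sum_congr rfl fun i hi => by simp_all)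
    hw'mem.1
  simp only [← dotProduct_muW] at hshift
  have hvu' : norm2 u = v ⬝ᵥ muW X w - v ⬝ᵥ muW X wstar := by
    rw [← hvu, ← dotProduct_sub]; rfl
  rw [hvu']
  rw [← hlam_def] at hvar
  set V := ∑ i, w i * (v ⬝ᵥ X i - v ⬝ᵥ muW X w) ^ 2
  set V' := ∑ i, w' i * (v ⬝ᵥ X i - v ⬝ᵥ muW X w') ^ 2
  generalize v ⬝ᵥ muW X w = m at *
  generalize v ⬝ᵥ muW X w' = m' at *
  generalize v ⬝ᵥ muW X wstar = ms at *
  set t := δ ^ 2 / ε with ht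
  have ht0 : 0 ≤ t := by positivity
  have hεt : ε * t = δ ^ 2 := by rw [ht]; field_simp
  have hεt' : ε ≤ t := by rw [ht, le_div_iff₀ hε]; nlinarith
  have hexc : V - (1 - β) * V' ≤ lam + 3 * t := by
    have : (1 - β) * (1 - t) ≤ (1 - β) * V' :=
      mul_le_mul_of_nonneg_left (by linarith) (by linarith)
    nlinarith [mul_nonneg hβ0 ht0]
  have hD : (m - m') ^ 2 ≤ 5 / 4 * (ε * (lam + 3 * t)) := by
    have h1 : β * (V - (1 - β) * V') ≤ 10 / 9 * ε * (lam + 3 * t) :=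
      (mul_le_mul_of_nonneg_left hexc hβ0).trans
        (mul_le_mul_of_nonneg_right hβ2 (by positivity))
    have h2 : 8 / 9 * (m - m') ^ 2 ≤ (1 - β) * (m - m') ^ 2 :=
      mul_le_mul_of_nonneg_right (by linarith) (sq_nonneg _)
    linarith
  have hE : (m' - ms) ^ 2 ≤ (2 * δ) ^ 2 := sq_le_sq' (by linarith) (by linarith)
  have hεlam : 0 ≤ ε * lam := by positivity
  nlinarith [sq_nonneg ((m - m') - (m' - ms))]
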